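/- Let g ≥ 7 be an integer with g ≡ 1 (mod 3). Then the maximum of g + r(P) − 3 − c(P), taken over all maximal lattice polygons P with exactly g interior lattice points and expected gonality egon(P) = 4, equals (5g + 13)/3; that is, some such P attains this value and every such P satisfies g + r(P) − 3 − c(P) ≤ (5g + 13)/3. (Note (5g + 13)/3 = ⌊U(g, 4)⌋ where U(g, d) = g + 2g/(d − 1) + 2d − 3.) -/

import Mathlib

open Set

noncomputable section

/-- Embedding of the integer lattice `ℤ × ℤ` into the real plane. -/
def latticeEmbed (p : ℤ × ℤ) : ℝ × ℝ := ((p.1 : ℝ), (p.2 : ℝ))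

/-- A lattice polygon: the convex hull of a nonempty finite set of lattice points. -/
def IsLatticePolygon (P : Set (ℝ × ℝ)) : Prop :=
  ∃ S : Finset (ℤ × ℤ), S.Nonempty ∧
    P = convexHull ℝ (latticeEmbed '' (S : Set (ℤ × ℤ)))

/-- The interior lattice points of a set in the plane. -/
def interiorLatticePoints (P : Set (ℝ × ℝ)) : Set (ℤ × ℤ) :=
  {p : ℤ × ℤ | latticeEmbed p ∈ interior P}

/-- The genus of a lattice polygon: the number of interior lattice points. -/
def polygonGenus (P : Set (ℝ × ℝ)) : ℕ := (interiorLatticePoints P).ncard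

/-- The number of lattice points on the boundary. -/
def boundaryLatticeCount (P : Set (ℝ × ℝ)) : ℕ :=
  {p : ℤ × ℤ | latticeEmbed p ∈ frontier P}.ncard

/-- A subset of the plane is two-dimensional if it has nonempty interior. -/
def TwoDimensional (P : Set (ℝ × ℝ)) : Prop := (interior P).Nonempty

/-- A `ℤ`-affine transformation of the plane: `p ↦ A p + b` with `A ∈ GL₂(ℤ)`, `b ∈ ℤ²`. -/
def IsZAffine (φ : ℝ × ℝ → ℝ × ℝ) : Prop :=
  ∃ a b c d e f : ℤ, (a * d - b * c = 1 ∨ a * d - b * c = -1) ∧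
    ∀ p : ℝ × ℝ,
      φ p = ((a : ℝ) * p.1 + (b : ℝ) * p.2 + (e : ℝ),
             (c : ℝ) * p.1 + (d : ℝ) * p.2 + (f : ℝ))

/-- The horizontal strip `ℝ × [0, s]`. -/
def strip (s : ℝ) : Set (ℝ × ℝ) := {q : ℝ × ℝ | 0 ≤ q.2 ∧ q.2 ≤ s}

/-- `LatticeWidthIs P d` : `d` is the smallest positive integer `s` such that some
`ℤ`-affine transformation maps `P` into the strip `ℝ × [0, s]`. -/
def LatticeWidthIs (P : Set (ℝ × ℝ)) (d : ℕ) : Prop :=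
  IsLeast {s : ℕ | 0 < s ∧ ∃ φ, IsZAffine φ ∧ φ '' P ⊆ strip (s : ℝ)} d

/-- An edge of a polygon: an exposed face of dimension one. -/
def IsEdge (P τ : Set (ℝ × ℝ)) : Prop :=
  IsExposed ℝ P τ ∧ Module.finrank ℝ (vectorSpan ℝ τ) = 1

/-- A column vector of a polygon `P`: a nonzero integer vector `v` such that for some
edge `τ` of `P`, translating all lattice points of `P` off `τ` by `v` stays in `P`. -/
def IsColumnVector (P : Set (ℝ × ℝ)) (v : ℤ × ℤ) : Prop :=
  v ≠ 0 ∧ ∃ τ : Set (ℝ × ℝ), IsEdge P τ ∧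
    ∀ p : ℤ × ℤ, latticeEmbed p ∈ P \ τ → latticeEmbed (p + v) ∈ P

/-- The number of column vectors of `P`. -/
def columnVectorCount (P : Set (ℝ × ℝ)) : ℕ :=
  {v : ℤ × ℤ | IsColumnVector P v}.ncard

/-- A lattice polygon is maximal if no lattice polygon strictly containing it has the
same set of interior lattice points. -/
def IsMaximalPolygon (P : Set (ℝ × ℝ)) : Prop :=
  IsLatticePolygon P ∧
    ∀ Q : Set (ℝ × ℝ), IsLatticePolygon Q → P ⊆ Q →
      interiorLatticePoints Q = interiorLatticePoints P → Q = P

/-- The interior polygon: the convex hull of the interior lattice points. -/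
def interiorPolygon (P : Set (ℝ × ℝ)) : Set (ℝ × ℝ) :=
  convexHull ℝ (latticeEmbed '' interiorLatticePoints P)

/-- A lattice polygon is non-hyperelliptic if its interior polygon is two-dimensional. -/
def NonHyperelliptic (P : Set (ℝ × ℝ)) : Prop := TwoDimensional (interiorPolygon P)

/-- Two polygons are equivalent if one is the image of the other under a
`ℤ`-affine transformation. -/
def EquivPolygon (P Q : Set (ℝ × ℝ)) : Prop := ∃ φ, IsZAffine φ ∧ φ '' P = Q

/-- The triangle `2Υ = conv{(−2,−2),(2,0),(0,2)}`. -/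
def twoUpsilon : Set (ℝ × ℝ) :=
  convexHull ℝ {((-2 : ℝ), (-2 : ℝ)), ((2 : ℝ), (0 : ℝ)), ((0 : ℝ), (2 : ℝ))}

/-- `ExpectedGonalityIs P d` : the expected gonality of `P` is `d`, i.e.
`d = lw(P⁽¹⁾) + 2`, except that polygons equivalent to `2Υ` have expected gonality `3`. -/
def ExpectedGonalityIs (P : Set (ℝ × ℝ)) (d : ℕ) : Prop :=
  (EquivPolygon P twoUpsilon ∧ d = 3) ∨
  (¬ EquivPolygon P twoUpsilon ∧
    ∃ w : ℕ, LatticeWidthIs (interiorPolygon P) w ∧ d = w + 2)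

/-- `Q` contains a crystal of length `d`: a `(d+1) × (d−1)` grid of interior lattice
points occupying columns `x₀, …, x₀ + d` and rows `1, …, d − 1`. -/
def ContainsCrystal (Q : Set (ℝ × ℝ)) (d : ℕ) : Prop :=
  ∃ x₀ : ℤ, ∀ i j : ℤ, 0 ≤ i → i ≤ (d : ℤ) → 1 ≤ j → j ≤ (d : ℤ) - 1 →
    (x₀ + i, j) ∈ interiorLatticePoints Q

/-- The shear transformation `(x, y) ↦ (x + ℓ y, y)`. -/
def shearMap (ℓ : ℤ) : ℝ × ℝ → ℝ × ℝ := fun q => (q.1 + (ℓ : ℝ) * q.2, q.2)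

end

namespace Stmt12Aux

lemma interior_move {Q : Set (ℝ × ℝ)} {p : ℝ × ℝ} (hp : p ∈ interior Q) (u v : ℝ) :
    ∃ t : ℝ, 0 < t ∧ ((p.1 + t * u, p.2 + t * v) : ℝ × ℝ) ∈ Q := by
  have hc : Continuous (fun t : ℝ => ((p.1 + t * u, p.2 + t * v) : ℝ × ℝ)) := by fun_prop
  have h0 : Filter.Tendsto (fun t : ℝ => ((p.1 + t * u, p.2 + t * v) : ℝ × ℝ))
      (nhdsWithin 0 (Set.Ioi 0)) (nhds p) := by
    have := hc.tendsto 0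
    simp only [zero_mul, add_zero] at this
    exact this.mono_left nhdsWithin_le_nhds
  have h1 := h0.eventually (mem_interior_iff_mem_nhds.1 hp)
  obtain ⟨t, ht, ht'⟩ := (h1.and self_mem_nhdsWithin).exists
  exact ⟨t, ht', ht⟩

lemma int_seg {Q : Set (ℝ × ℝ)} (hQ : Convex ℝ Q) {p q z : ℝ × ℝ} (hp : p ∈ interior Q)
    (hq : q ∈ Q) (s : ℝ) (hs0 : 0 ≤ s) (hs1 : s < 1)
    (h1 : z.1 = (1 - s) * p.1 + s * q.1) (h2 : z.2 = (1 - s) * p.2 + s * q.2) :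
    z ∈ interior Q := by
  have := hQ.combo_interior_self_mem_interior hp hq (a := 1 - s) (b := s) (by linarith) hs0
    (by ring)
  convert this using 1
  ext <;> simp [h1, h2]

lemma seg_mem {Q : Set (ℝ × ℝ)} (hQ : Convex ℝ Q) {p q z : ℝ × ℝ} (hp : p ∈ Q)
    (hq : q ∈ Q) (s : ℝ) (hs0 : 0 ≤ s) (hs1 : s ≤ 1)
    (h1 : z.1 = (1 - s) * p.1 + s * q.1) (h2 : z.2 = (1 - s) * p.2 + s * q.2) :
    z ∈ Q := by
  have := hQ hp hq (a := 1 - s) (b := s) (by linarith) hs0 (by ring)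
  convert this using 1
  ext <;> simp [h1, h2]

/-- crossing lemma -/
lemma line_int {Q : Set (ℝ × ℝ)} (hQ : Convex ℝ Q) {p q w : ℝ × ℝ} (d1 d2 α β : ℝ)
    (hα : 0 < α) (hβ : 0 < β) (hd : 0 < d1 ^ 2 + d2 ^ 2)
    (hA : ((p.1 - α * d1, p.2 - α * d2) : ℝ × ℝ) ∈ Q)
    (hB : ((p.1 + β * d1, p.2 + β * d2) : ℝ × ℝ) ∈ Q)
    (hq : q ∈ interior Q) (hw : w ∈ Q)
    (h1 : d1 * q.2 - d2 * q.1 ≤ d1 * p.2 - d2 * p.1)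
    (h2 : d1 * p.2 - d2 * p.1 < d1 * w.2 - d2 * w.1) : p ∈ interior Q := by
  obtain ⟨p1, p2⟩ := p
  obtain ⟨q1, q2⟩ := q
  obtain ⟨w1, w2⟩ := w
  simp only at *
  set t : ℝ := ((d1 * p2 - d2 * p1) - (d1 * q2 - d2 * q1)) /
    ((d1 * w2 - d2 * w1) - (d1 * q2 - d2 * q1)) with ht
  have hpos : 0 < (d1 * w2 - d2 * w1) - (d1 * q2 - d2 * q1) := by linarith
  have ht0 : 0 ≤ t := div_nonneg (by linarith) hpos.le
  have ht1 : t < 1 := by rw [ht, div_lt_one hpos]; linarith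
  have htm : t * ((d1 * w2 - d2 * w1) - (d1 * q2 - d2 * q1)) =
      (d1 * p2 - d2 * p1) - (d1 * q2 - d2 * q1) := by
    rw [ht]; field_simp
  clear_value t
  set r1 : ℝ := (1 - t) * q1 + t * w1 with hr1
  set r2 : ℝ := (1 - t) * q2 + t * w2 with hr2
  have hr : ((r1, r2) : ℝ × ℝ) ∈ interior Q := int_seg hQ hq hw t ht0 ht1 rfl rfl
  have hN : d1 * (r2 - p2) - d2 * (r1 - p1) = 0 := by
    rw [hr1, hr2]; linear_combination htm
  clear_value r1 r2
  obtain ⟨μ, hμ1, hμ2⟩ : ∃ μ : ℝ, r1 = p1 + μ * d1 ∧ r2 = p2 + μ * d2 := by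
    refine ⟨((r1 - p1) * d1 + (r2 - p2) * d2) / (d1 ^ 2 + d2 ^ 2), ?_, ?_⟩
    · field_simp
      linear_combination (-d2) * hN
    · field_simp
      linear_combination (d1) * hN
  rcases le_total 0 μ with h | h
  · refine int_seg hQ hr hA (μ / (α + μ)) (by positivity) ?_ ?_ ?_
    · rw [div_lt_one (by positivity)]; linarith
    · simp only [hμ1]; field_simp; ring
    · simp only [hμ2]; field_simp; ring
  · have hb : 0 < β - μ := by linarith
    refine int_seg hQ hr hB (-μ / (β - μ)) (div_nonneg (by linarith) hb.le) ?_ ?_ ?_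
    · rw [div_lt_one hb]; linarith
    · simp only [hμ1]; field_simp; ring
    · simp only [hμ2]; field_simp; ring

lemma zaffine_inv {φ : ℝ × ℝ → ℝ × ℝ} (hφ : IsZAffine φ) :
    (∃ H : (ℝ × ℝ) ≃ₜ (ℝ × ℝ), ⇑H = φ) ∧
    (∃ σ : (ℤ × ℤ) ≃ (ℤ × ℤ), ∀ p, latticeEmbed (σ p) = φ (latticeEmbed p)) ∧
    (∃ A : (ℝ × ℝ) →ᵃ[ℝ] (ℝ × ℝ), ⇑A = φ) := by
  obtain ⟨a, b, c, d, e, f, hdet, h⟩ := hφ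
  obtain ⟨D, hD, hDD⟩ : ∃ D : ℤ, a * d - b * c = D ∧ D * D = 1 := by
    rcases hdet with h | h
    · exact ⟨1, h, rfl⟩
    · exact ⟨-1, h, rfl⟩
  have hDr : (a : ℝ) * d - b * c = D := by exact_mod_cast hD
  have hDDr : (D : ℝ) * D = 1 := by exact_mod_cast hDD
  have hφ : φ = fun p => ((a : ℝ) * p.1 + (b : ℝ) * p.2 + (e : ℝ),
             (c : ℝ) * p.1 + (d : ℝ) * p.2 + (f : ℝ)) := funext h
  refine ⟨⟨⟨⟨φ, fun p => ((D : ℝ) * (d * (p.1 - e) - b * (p.2 - f)),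
      (D : ℝ) * (a * (p.2 - f) - c * (p.1 - e))), ?_, ?_⟩, ?_, ?_⟩, rfl⟩, ?_, ?_⟩
  · intro p
    ext
    · simp only [h]; linear_combination (D * p.1) * hDr + p.1 * hDDr
    · simp only [h]; linear_combination (D * p.2) * hDr + p.2 * hDDr
  · intro p
    ext
    · simp only [h]; linear_combination (D * (p.1 - e)) * hDr + (p.1 - e) * hDDr
    · simp only [h]; linear_combination (D * (p.2 - f)) * hDr + (p.2 - f) * hDDr
  · show Continuous φ
    rw [hφ]; fun_prop
  · show Continuous (fun p : ℝ × ℝ => ((D : ℝ) * (d * (p.1 - e) - b * (p.2 - f)),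
      (D : ℝ) * (a * (p.2 - f) - c * (p.1 - e))))
    fun_prop
  · refine ⟨⟨fun p => (a * p.1 + b * p.2 + e, c * p.1 + d * p.2 + f),
      fun p => (D * (d * (p.1 - e) - b * (p.2 - f)), D * (a * (p.2 - f) - c * (p.1 - e))),
      ?_, ?_⟩, ?_⟩
    · intro p
      ext
      · simp only; linear_combination (D * p.1) * hD + p.1 * hDD
      · simp only; linear_combination (D * p.2) * hD + p.2 * hDD
    · intro p
      ext
      · simp only; linear_combination (D * (p.1 - e)) * hD + (p.1 - e) * hDD
      · simp only; linear_combination (D * (p.2 - f)) * hD + (p.2 - f) * hDD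
    · intro p
      simp [latticeEmbed, h]
  · refine ⟨((((a : ℝ) • LinearMap.fst ℝ ℝ ℝ + (b : ℝ) • LinearMap.snd ℝ ℝ ℝ).prod
      ((c : ℝ) • LinearMap.fst ℝ ℝ ℝ + (d : ℝ) • LinearMap.snd ℝ ℝ ℝ)).toAffineMap +
      AffineMap.const ℝ (ℝ × ℝ) ((e : ℝ), (f : ℝ))), ?_⟩
    ext p <;> simp [h]

lemma image_set_eq {σ : (ℤ × ℤ) ≃ (ℤ × ℤ)} {φ : ℝ × ℝ → ℝ × ℝ}
    (hinj : Function.Injective φ)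
    (hσ : ∀ p, latticeEmbed (σ p) = φ (latticeEmbed p)) (T : Set (ℝ × ℝ)) :
    {p : ℤ × ℤ | latticeEmbed p ∈ φ '' T} = σ '' {p : ℤ × ℤ | latticeEmbed p ∈ T} := by
  ext p
  obtain ⟨q, rfl⟩ := σ.surjective p
  simp only [mem_ofPred_eq, hσ, hinj.mem_set_image, σ.injective.mem_set_image]

lemma genus_image {φ : ℝ × ℝ → ℝ × ℝ} (hφ : IsZAffine φ) (P : Set (ℝ × ℝ)) :
    polygonGenus (φ '' P) = polygonGenus P := by
  obtain ⟨⟨H, rfl⟩, ⟨σ, hσ⟩, -⟩ := zaffine_inv hφ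
  unfold polygonGenus interiorLatticePoints
  rw [← H.image_interior, image_set_eq H.injective hσ, ncard_image_of_injective _ σ.injective]

lemma boundary_image {φ : ℝ × ℝ → ℝ × ℝ} (hφ : IsZAffine φ) (P : Set (ℝ × ℝ)) :
    boundaryLatticeCount (φ '' P) = boundaryLatticeCount P := by
  obtain ⟨⟨H, rfl⟩, ⟨σ, hσ⟩, -⟩ := zaffine_inv hφ
  unfold boundaryLatticeCount
  rw [← H.image_frontier, image_set_eq H.injective hσ, ncard_image_of_injective _ σ.injective]

lemma interior_image {φ : ℝ × ℝ → ℝ × ℝ} (hφ : IsZAffine φ) (P : Set (ℝ × ℝ)) (p : ℤ × ℤ) :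
    p ∈ interiorLatticePoints (φ '' P) ↔
      ∃ q ∈ interiorLatticePoints P, latticeEmbed p = φ (latticeEmbed q) := by
  obtain ⟨⟨H, rfl⟩, ⟨σ, hσ⟩, -⟩ := zaffine_inv hφ
  unfold interiorLatticePoints
  rw [← H.image_interior, image_set_eq H.injective hσ]
  have hinj : Function.Injective latticeEmbed := by
    rintro ⟨a, b⟩ ⟨c, d⟩ h
    simpa [latticeEmbed] using h
  constructor
  · rintro ⟨q, hq, rfl⟩
    exact ⟨q, hq, hσ q⟩
  · rintro ⟨q, hq, h⟩
    refine ⟨q, hq, hinj ?_⟩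
    rw [hσ, h]

lemma polygon_image {φ : ℝ × ℝ → ℝ × ℝ} (hφ : IsZAffine φ) {P : Set (ℝ × ℝ)}
    (hP : IsLatticePolygon P) : IsLatticePolygon (φ '' P) := by
  classical
  obtain ⟨-, ⟨σ, hσ⟩, ⟨A, rfl⟩⟩ := zaffine_inv hφ
  obtain ⟨S, hS, rfl⟩ := hP
  refine ⟨S.image σ, hS.image _, ?_⟩
  rw [AffineMap.image_convexHull, Finset.coe_image, image_image, image_image]
  simp only [hσ]

lemma strip_of {φ : ℝ × ℝ → ℝ × ℝ} (hφ : IsZAffine φ) (P : Set (ℝ × ℝ)) (s : ℝ)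
    (h : ∀ p ∈ interiorLatticePoints P, φ (latticeEmbed p) ∈ strip s) :
    φ '' interiorPolygon P ⊆ strip s := by
  obtain ⟨-, -, ⟨A, rfl⟩⟩ := zaffine_inv hφ
  unfold interiorPolygon
  rw [AffineMap.image_convexHull]
  apply convexHull_min
  · rintro _ ⟨_, ⟨p, hp, rfl⟩, rfl⟩
    exact h p hp
  · intro x hx y hy a b ha hb hab
    simp only [strip, mem_ofPred_eq, Prod.snd_add, Prod.smul_snd, smul_eq_mul] at *
    constructor
    · nlinarith
    · nlinarith [mul_le_mul_of_nonneg_left hx.2 ha, mul_le_mul_of_nonneg_left hy.2 hb]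

def hexSet (k : ℕ) : Set (ℝ × ℝ) :=
  {q | (0 ≤ q.2 ∧ q.2 ≤ 4) ∧ (0 ≤ q.1 ∧ q.1 ≤ k + 2) ∧ (2 ≤ q.1 + q.2 ∧ q.1 + q.2 ≤ k + 4)}

lemma mem_hex (k : ℕ) (x y : ℝ) : ((x, y) : ℝ × ℝ) ∈ hexSet k ↔
    (0 ≤ y ∧ y ≤ 4) ∧ (0 ≤ x ∧ x ≤ k + 2) ∧ (2 ≤ x + y ∧ x + y ≤ k + 4) := Iff.rfl

lemma hex_convex (k : ℕ) : Convex ℝ (hexSet k) := by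
  rintro ⟨x1, x2⟩ hx ⟨y1, y2⟩ hy a b ha hb hab
  obtain rfl : b = 1 - a := by linarith
  simp only [Prod.smul_mk, smul_eq_mul, Prod.mk_add_mk, mem_hex] at *
  obtain ⟨⟨h1, h2⟩, ⟨h3, h4⟩, h5, h6⟩ := hx
  obtain ⟨⟨g1, g2⟩, ⟨g3, g4⟩, g5, g6⟩ := hy
  refine ⟨⟨?_, ?_⟩, ⟨?_, ?_⟩, ?_, ?_⟩ <;> nlinarith

lemma hex_interior (k : ℕ) (x y : ℝ) : ((x, y) : ℝ × ℝ) ∈ interior (hexSet k) ↔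
    (0 < y ∧ y < 4) ∧ (0 < x ∧ x < k + 2) ∧ (2 < x + y ∧ x + y < k + 4) := by
  constructor
  · intro h
    obtain ⟨t1, ht1, h1⟩ := interior_move h 1 0
    obtain ⟨t2, ht2, h2⟩ := interior_move h (-1) 0
    obtain ⟨t3, ht3, h3⟩ := interior_move h 0 1
    obtain ⟨t4, ht4, h4⟩ := interior_move h 0 (-1)
    simp only [mem_hex] at h1 h2 h3 h4
    refine ⟨⟨?_, ?_⟩, ⟨?_, ?_⟩, ?_, ?_⟩ <;> linarith
  · intro h
    have ho : IsOpen {q : ℝ × ℝ | (0 < q.2 ∧ q.2 < 4) ∧ (0 < q.1 ∧ q.1 < k + 2) ∧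
        (2 < q.1 + q.2 ∧ q.1 + q.2 < k + 4)} := by
      refine IsOpen.and (IsOpen.and ?_ ?_) (IsOpen.and (IsOpen.and ?_ ?_) (IsOpen.and ?_ ?_)) <;>
      exact isOpen_lt (by fun_prop) (by fun_prop)
    refine interior_maximal ?_ ho h
    rintro q ⟨⟨h1, h2⟩, ⟨h3, h4⟩, h5, h6⟩
    exact ⟨⟨h1.le, h2.le⟩, ⟨h3.le, h4.le⟩, h5.le, h6.le⟩

def hexS (k : ℕ) : Finset (ℤ × ℤ) :=
  {(2, 0), ((k : ℤ) + 2, 0), ((k : ℤ) + 2, 2), ((k : ℤ), 4), (0, 4), (0, 2)}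

lemma hex_hull (k : ℕ) : hexSet k = convexHull ℝ (latticeEmbed '' (hexS k : Set (ℤ × ℤ))) := by
  have hk : (0 : ℝ) ≤ k := Nat.cast_nonneg k
  apply Subset.antisymm
  · rintro ⟨x, y⟩ h
    rw [mem_hex] at h
    obtain ⟨⟨h1, h2⟩, ⟨h3, h4⟩, h5, h6⟩ := h
    set C := convexHull ℝ (latticeEmbed '' (hexS k : Set (ℤ × ℤ))) with hC
    have hcv : Convex ℝ C := convex_convexHull _ _
    have hv : ∀ a b : ℤ, (a, b) ∈ hexS k → (((a : ℝ), (b : ℝ)) : ℝ × ℝ) ∈ C := by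
      intro a b hab
      exact subset_convexHull _ _ ⟨(a, b), hab, rfl⟩
    have v1 : (((2 : ℝ), (0 : ℝ)) : ℝ × ℝ) ∈ C := by
      simpa using hv 2 0 (by simp [hexS])
    have v2 : (((k : ℝ) + 2, (0 : ℝ)) : ℝ × ℝ) ∈ C := by
      simpa using hv (k + 2) 0 (by simp [hexS])
    have v3 : (((k : ℝ) + 2, (2 : ℝ)) : ℝ × ℝ) ∈ C := by
      simpa using hv (k + 2) 2 (by simp [hexS])
    have v4 : (((k : ℝ), (4 : ℝ)) : ℝ × ℝ) ∈ C := by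
      simpa using hv k 4 (by simp [hexS])
    have v5 : (((0 : ℝ), (4 : ℝ)) : ℝ × ℝ) ∈ C := by
      simpa using hv 0 4 (by simp [hexS])
    have v6 : (((0 : ℝ), (2 : ℝ)) : ℝ × ℝ) ∈ C := by
      simpa using hv 0 2 (by simp [hexS])
    clear_value C
    have key : ∀ l r : ℝ, l ≤ x → x ≤ r → ((l, y) : ℝ × ℝ) ∈ C → ((r, y) : ℝ × ℝ) ∈ C →
        ((x, y) : ℝ × ℝ) ∈ C := by
      intro l r hl hr hlC hrC
      rcases eq_or_lt_of_le (hl.trans hr) with h | h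
      · obtain rfl : l = x := by linarith
        exact hlC
      · have h' : 0 < r - l := by linarith
        refine seg_mem hcv hlC hrC ((x - l) / (r - l)) (div_nonneg (by linarith) h'.le) ?_ ?_ ?_
        · rw [div_le_one h']; linarith
        · simp only; field_simp; ring
        · simp only; ring
    rcases le_total y 2 with hy | hy
    · refine key (2 - y) (k + 2) (by linarith) h4 ?_ ?_
      · exact seg_mem hcv v1 v6 (y / 2) (by linarith) (by linarith) (by simp; ring) (by simp)
      · exact seg_mem hcv v2 v3 (y / 2) (by linarith) (by linarith) (by simp; ring) (by simp)
    · refine key 0 (k + 4 - y) h3 (by linarith) ?_ ?_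
      · exact seg_mem hcv v6 v5 ((y - 2) / 2) (by linarith) (by linarith) (by simp)
          (by simp; ring)
      · exact seg_mem hcv v3 v4 ((y - 2) / 2) (by linarith) (by linarith) (by simp; ring)
          (by simp; ring)
  · apply convexHull_min _ (hex_convex k)
    rintro _ ⟨p, hp, rfl⟩
    simp only [hexS, Finset.coe_insert, Finset.coe_singleton, mem_insert_iff,
      mem_singleton_iff] at hp
    rcases hp with rfl | rfl | rfl | rfl | rfl | rfl <;> simp only [latticeEmbed, mem_hex] <;>
      push_cast <;> refine ⟨⟨?_, ?_⟩, ⟨?_, ?_⟩, ?_, ?_⟩ <;> linarith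

lemma hex_polygon (k : ℕ) : IsLatticePolygon (hexSet k) :=
  ⟨hexS k, ⟨(2, 0), by simp [hexS]⟩, hex_hull k⟩

lemma hex_lat (k : ℕ) (p : ℤ × ℤ) : latticeEmbed p ∈ hexSet k ↔
    (0 ≤ p.2 ∧ p.2 ≤ 4) ∧ (0 ≤ p.1 ∧ p.1 ≤ k + 2) ∧ (2 ≤ p.1 + p.2 ∧ p.1 + p.2 ≤ k + 4) := by
  unfold latticeEmbed
  rw [mem_hex]
  norm_cast

lemma hex_lat_int (k : ℕ) (p : ℤ × ℤ) : latticeEmbed p ∈ interior (hexSet k) ↔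
    (0 < p.2 ∧ p.2 < 4) ∧ (0 < p.1 ∧ p.1 < k + 2) ∧ (2 < p.1 + p.2 ∧ p.1 + p.2 < k + 4) := by
  unfold latticeEmbed
  rw [hex_interior]
  norm_cast

lemma hex_closed (k : ℕ) : IsClosed (hexSet k) := by
  refine IsClosed.and (IsClosed.and ?_ ?_) (IsClosed.and (IsClosed.and ?_ ?_)
    (IsClosed.and ?_ ?_)) <;> exact isClosed_le (by fun_prop) (by fun_prop)

lemma hex_maximal (k : ℕ) (hk : 2 ≤ k) : IsMaximalPolygon (hexSet k) := by
  refine ⟨hex_polygon k, ?_⟩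
  rintro Q ⟨S, hS, hQS⟩ hPQ hint
  refine Subset.antisymm ?_ hPQ
  have hcv : Convex ℝ Q := by rw [hQS]; exact convex_convexHull _ _
  have hkr : (2 : ℝ) ≤ k := by exact_mod_cast hk
  have hq : ((2 : ℝ), (2 : ℝ)) ∈ interior Q := by
    refine interior_mono hPQ ?_
    rw [hex_interior]
    refine ⟨⟨?_, ?_⟩, ⟨?_, ?_⟩, ?_, ?_⟩ <;> linarith
  -- a boundary lattice point cannot become interior
  have hno : ∀ (w : ℤ × ℤ) (p d : ℤ × ℤ), latticeEmbed w ∈ Q →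
      latticeEmbed (p - d) ∈ hexSet k → latticeEmbed (p + d) ∈ hexSet k →
      latticeEmbed p ∉ interior (hexSet k) → 0 < d.1 ^ 2 + d.2 ^ 2 →
      d.1 * 2 - d.2 * 2 ≤ d.1 * p.2 - d.2 * p.1 →
      d.1 * w.2 - d.2 * w.1 ≤ d.1 * p.2 - d.2 * p.1 := by
    intro w p d hw hA hB hp hd h1
    by_contra! h2
    have : p ∈ interiorLatticePoints (hexSet k) := by
      rw [← hint]
      refine line_int hcv (d1 := d.1) (d2 := d.2) (α := 1) (β := 1) one_pos one_pos
        (by exact_mod_cast hd) ?_ ?_ hq hw ?_ ?_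
      · apply hPQ; simpa [latticeEmbed] using hA
      · apply hPQ; simpa [latticeEmbed] using hB
      · simp only [latticeEmbed]; exact_mod_cast h1
      · simp only [latticeEmbed]; exact_mod_cast h2
    exact hp this
  rw [hQS]
  apply convexHull_min _ (hex_convex k)
  rintro _ ⟨w, hw, rfl⟩
  have hwQ : latticeEmbed w ∈ Q := by rw [hQS]; exact subset_convexHull _ _ ⟨w, hw, rfl⟩
  have e1 := hno w (3, 0) (-1, 0) hwQ
  have e2 := hno w (1, 4) (1, 0) hwQ
  have e3 := hno w (0, 3) (0, 1) hwQ
  have e4 := hno w (k + 2, 1) (0, -1) hwQ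
  have e5 := hno w (1, 1) (-1, 1) hwQ
  have e6 := hno w (k + 1, 3) (1, -1) hwQ
  simp only [hex_lat, hex_lat_int, Prod.fst_add, Prod.snd_add, Prod.fst_sub, Prod.snd_sub] at *
  refine ⟨⟨?_, ?_⟩, ⟨?_, ?_⟩, ?_, ?_⟩
  · have := e1 (by omega) (by omega) (by omega) (by omega) (by omega); omega
  · have := e2 (by omega) (by omega) (by omega) (by omega) (by omega); omega
  · have := e3 (by omega) (by omega) (by omega) (by omega) (by omega); omega
  · have := e4 (by omega) (by omega) (by omega) (by omega) (by omega); omega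
  · have := e5 (by omega) (by omega) (by omega) (by omega) (by omega); omega
  · have := e6 (by omega) (by omega) (by omega) (by omega) (by omega); omega

noncomputable def rowF (a b y : ℤ) : Finset (ℤ × ℤ) := (Finset.Icc a b) ×ˢ {y}

lemma mem_rowF (a b y : ℤ) (p : ℤ × ℤ) : p ∈ rowF a b y ↔ (a ≤ p.1 ∧ p.1 ≤ b) ∧ p.2 = y := by
  rw [rowF, Finset.mem_product, Finset.mem_Icc, Finset.mem_singleton]

lemma card_rowF (a b y : ℤ) : (rowF a b y).card = (b + 1 - a).toNat := by
  simp [rowF]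

lemma disj_rowF {a b y a' b' y' : ℤ} (h : y ≠ y') : Disjoint (rowF a b y) (rowF a' b' y') := by
  rw [Finset.disjoint_left]
  intro p hp hp'
  rw [mem_rowF] at hp hp'
  omega

lemma hex_genus (k : ℕ) : polygonGenus (hexSet k) = 3 * k + 1 := by
  unfold polygonGenus interiorLatticePoints
  have : {p : ℤ × ℤ | latticeEmbed p ∈ interior (hexSet k)} =
      ((rowF 2 (k + 1) 1 ∪ (rowF 1 (k + 1) 2 ∪ rowF 1 k 3) : Finset (ℤ × ℤ)) : Set (ℤ × ℤ)) := by
    ext p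
    simp only [mem_ofPred_eq, Finset.mem_coe, Finset.mem_union, mem_rowF, hex_lat_int]
    omega
  rw [this, ncard_coe_finset, Finset.card_union_of_disjoint, Finset.card_union_of_disjoint]
  · simp only [card_rowF]; omega
  · exact disj_rowF (by norm_num)
  · rw [Finset.disjoint_union_right]
    exact ⟨disj_rowF (by norm_num), disj_rowF (by norm_num)⟩

lemma hex_boundary (k : ℕ) : boundaryLatticeCount (hexSet k) = 2 * k + 8 := by
  unfold boundaryLatticeCount
  have : {p : ℤ × ℤ | latticeEmbed p ∈ frontier (hexSet k)} =
      ((rowF 2 (k + 2) 0 ∪ (rowF 0 k 4 ∪ {(1, 1), ((k : ℤ) + 2, 1), (0, 2), ((k : ℤ) + 2, 2),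
        (0, 3), ((k : ℤ) + 1, 3)}) : Finset (ℤ × ℤ)) : Set (ℤ × ℤ)) := by
    ext p
    simp only [mem_ofPred_eq, Finset.mem_coe, Finset.mem_union, mem_rowF, (hex_closed k).frontier_eq,
      mem_sdiff, hex_lat_int, hex_lat, Finset.mem_insert, Finset.mem_singleton, Prod.ext_iff]
    omega
  rw [this, ncard_coe_finset, Finset.card_union_of_disjoint, Finset.card_union_of_disjoint]
  · simp only [card_rowF]
    rw [Finset.card_insert_of_notMem, Finset.card_insert_of_notMem, Finset.card_insert_of_notMem,
      Finset.card_insert_of_notMem, Finset.card_insert_of_notMem, Finset.card_singleton]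
    · omega
    all_goals simp only [Finset.mem_insert, Finset.mem_singleton, Prod.ext_iff]; omega
  · rw [Finset.disjoint_left]
    intro p hp hp'
    simp only [mem_rowF, Finset.mem_insert, Finset.mem_singleton, Prod.ext_iff] at hp hp'
    omega
  · rw [Finset.disjoint_left]
    intro p hp hp'
    simp only [mem_rowF, Finset.mem_union, Finset.mem_insert, Finset.mem_singleton,
      Prod.ext_iff] at hp hp'
    omega

lemma span_two {W : Submodule ℝ (ℝ × ℝ)} (h1 : ((1 : ℝ), (0 : ℝ)) ∈ W)
    (h2 : ((0 : ℝ), (1 : ℝ)) ∈ W) : Module.finrank ℝ W = 2 := by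
  have : W = ⊤ := by
    rw [eq_top_iff]
    rintro ⟨x, y⟩ -
    have := W.add_mem (W.smul_mem x h1) (W.smul_mem y h2)
    simpa using this
  rw [this, finrank_top]
  simp

lemma hex_column (k : ℕ) (hk : 2 ≤ k) : columnVectorCount (hexSet k) = 0 := by
  unfold columnVectorCount
  have : {v : ℤ × ℤ | IsColumnVector (hexSet k) v} = ∅ := by
    ext v
    simp only [mem_ofPred_eq, mem_empty_iff_false, iff_false]
    rintro ⟨hv, τ, ⟨-, hτ⟩, h⟩
    have hmem : ∀ p : ℤ × ℤ, latticeEmbed p ∈ hexSet k → latticeEmbed (p + v) ∉ hexSet k →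
        latticeEmbed p ∈ τ := by
      intro p hp hpv
      by_contra hpt
      exact hpv (h p ⟨hp, hpt⟩)
    have hspan : ∀ p d : ℤ × ℤ, latticeEmbed p ∈ hexSet k → latticeEmbed (p + v) ∉ hexSet k →
        latticeEmbed (p + d) ∈ hexSet k → latticeEmbed (p + d + v) ∉ hexSet k →
        ((d.1 : ℝ), (d.2 : ℝ)) ∈ vectorSpan ℝ τ := by
      intro p d h1 h2 h3 h4
      have := vsub_mem_vectorSpan ℝ (hmem _ h3 h4) (hmem _ h1 h2)
      simpa [latticeEmbed] using this
    simp only [hex_lat, Prod.fst_add, Prod.snd_add] at hspan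
    have ha : v.1 ≠ 0 → ((0 : ℝ), (1 : ℝ)) ∈ vectorSpan ℝ τ := by
      intro hne
      rcases lt_or_gt_of_ne hne with h | h
      · have := hspan (0, 2) (0, 1) (by omega) (by omega) (by omega) (by omega)
        simpa using this
      · have := hspan (k + 2, 0) (0, 1) (by omega) (by omega) (by omega) (by omega)
        simpa using this
    have hb : v.2 ≠ 0 → ((1 : ℝ), (0 : ℝ)) ∈ vectorSpan ℝ τ := by
      intro hne
      rcases lt_or_gt_of_ne hne with h | h
      · have := hspan (2, 0) (1, 0) (by omega) (by omega) (by omega) (by omega)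
        simpa using this
      · have := hspan (0, 4) (1, 0) (by omega) (by omega) (by omega) (by omega)
        simpa using this
    have hc : v.1 + v.2 ≠ 0 → ((1 : ℝ), (-1 : ℝ)) ∈ vectorSpan ℝ τ := by
      intro hne
      rcases lt_or_gt_of_ne hne with h | h
      · have := hspan (0, 2) (1, -1) (by omega) (by omega) (by omega) (by omega)
        simpa using this
      · have := hspan (k, 4) (1, -1) (by omega) (by omega) (by omega) (by omega)
        simpa using this
    have hfin : ((1 : ℝ), (0 : ℝ)) ∈ vectorSpan ℝ τ ∧ ((0 : ℝ), (1 : ℝ)) ∈ vectorSpan ℝ τ := by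
      by_cases h1 : v.1 = 0
      · have h2 : v.2 ≠ 0 := fun h2 => hv (Prod.ext h1 h2)
        refine ⟨hb h2, ?_⟩
        have := (vectorSpan ℝ τ).sub_mem (hb h2) (hc (by omega))
        simpa using this
      · refine ⟨?_, ha h1⟩
        by_cases h2 : v.2 = 0
        · have := (vectorSpan ℝ τ).add_mem (ha h1) (hc (by omega))
          simpa using this
        · exact hb h2
    have := span_two hfin.1 hfin.2
    omega
  rw [this, ncard_empty]

lemma upsilon_genus : polygonGenus twoUpsilon ≤ 4 := by
  have hsub : twoUpsilon ⊆ {q : ℝ × ℝ | q.1 + q.2 ≤ 2 ∧ q.1 - 2 * q.2 ≤ 2 ∧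
      q.2 - 2 * q.1 ≤ 2} := by
    apply convexHull_min
    · intro q hq
      simp only [mem_insert_iff, mem_singleton_iff] at hq
      rcases hq with rfl | rfl | rfl <;> norm_num
    · rintro ⟨x1, x2⟩ hx ⟨y1, y2⟩ hy a b ha hb hab
      obtain rfl : b = 1 - a := by linarith
      simp only [mem_ofPred_eq, Prod.smul_mk, smul_eq_mul, Prod.mk_add_mk] at *
      obtain ⟨h1, h2, h3⟩ := hx
      obtain ⟨g1, g2, g3⟩ := hy
      refine ⟨?_, ?_, ?_⟩ <;> nlinarith
  have h : interiorLatticePoints twoUpsilon ⊆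
      (({(-1, -1), (0, 0), (1, 0), (0, 1)} : Finset (ℤ × ℤ)) : Set (ℤ × ℤ)) := by
    intro p hp
    obtain ⟨t1, ht1, h1⟩ := interior_move hp 1 0
    obtain ⟨t2, ht2, h2⟩ := interior_move hp (-1) 0
    have h1 := hsub h1
    have h2 := hsub h2
    simp only [mem_ofPred_eq, latticeEmbed] at h1 h2
    have e1 : (p.1 : ℝ) + p.2 < 2 := by linarith [h1.1]
    have e2 : (p.1 : ℝ) - 2 * p.2 < 2 := by linarith [h1.2.1]
    have e3 : (p.2 : ℝ) - 2 * p.1 < 2 := by linarith [h2.2.2]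
    have e1 : p.1 + p.2 < 2 := by exact_mod_cast e1
    have e2 : p.1 - 2 * p.2 < 2 := by exact_mod_cast e2
    have e3 : p.2 - 2 * p.1 < 2 := by exact_mod_cast e3
    simp only [Finset.mem_coe, Finset.mem_insert, Finset.mem_singleton, Prod.ext_iff]
    omega
  unfold polygonGenus
  calc _ ≤ _ := ncard_le_ncard h (Finset.finite_toSet _)
    _ = _ := ncard_coe_finset _
    _ ≤ 4 := Finset.card_le_four

lemma hex_gonality (k : ℕ) (hk : 2 ≤ k) : ExpectedGonalityIs (hexSet k) 4 := by
  refine Or.inr ⟨?_, 2, ⟨⟨by norm_num, ?_⟩, ?_⟩, rfl⟩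
  · rintro ⟨φ, hφ, h⟩
    have h1 := genus_image hφ (hexSet k)
    rw [h, hex_genus] at h1
    have := upsilon_genus
    omega
  · have hz : IsZAffine (fun p : ℝ × ℝ => ((p.1, p.2 - 1) : ℝ × ℝ)) := by
      refine ⟨1, 0, 0, 1, 0, -1, by norm_num, fun p => ?_⟩
      ext
      · simp
      · simp; ring
    refine ⟨_, hz, strip_of hz _ _ ?_⟩
    intro p hp
    have hp := (hex_lat_int k p).1 hp
    have h1 : (1 : ℝ) ≤ p.2 := by exact_mod_cast (show (1 : ℤ) ≤ p.2 by omega)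
    have h2 : (p.2 : ℝ) ≤ 3 := by exact_mod_cast (show p.2 ≤ (3 : ℤ) by omega)
    simp only [strip, latticeEmbed, mem_ofPred_eq]
    push_cast
    constructor <;> linarith
  · rintro s ⟨hs, φ, ⟨a, b, c, d, e, f, hdet, h⟩, hsub⟩
    by_contra! hlt
    obtain rfl : s = 1 := by omega
    have key : ∀ p : ℤ × ℤ, p ∈ interiorLatticePoints (hexSet k) →
        0 ≤ c * p.1 + d * p.2 + f ∧ c * p.1 + d * p.2 + f ≤ 1 := by
      intro p hp
      have := hsub ⟨_, subset_convexHull _ _ ⟨p, hp, rfl⟩, rfl⟩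
      rw [h] at this
      simp only [strip, latticeEmbed, mem_ofPred_eq] at this
      exact_mod_cast this
    simp only [interiorLatticePoints, mem_ofPred_eq, hex_lat_int] at key
    have k1 := key (1, 2) (by omega)
    have k2 := key (3, 2) (by omega)
    have k3 := key (2, 1) (by omega)
    have k4 := key (2, 3) (by omega)
    have hc : c = 0 := by omega
    have hd : d = 0 := by omega
    subst hc hd
    simp at hdet

lemma side_arith (r0 r4 C1 C2 C3 b1 b2 b3 : ℤ) (R1 R2 R3 : ℝ)
    (h1 : (b1 = 1 ∧ R1 = C1) ∨ (b1 = 0 ∧ (C1 : ℝ) - 1 < R1 ∧ R1 < C1))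
    (h2 : (b2 = 1 ∧ R2 = C2) ∨ (b2 = 0 ∧ (C2 : ℝ) - 1 < R2 ∧ R2 < C2))
    (h3 : (b3 = 1 ∧ R3 = C3) ∨ (b3 = 0 ∧ (C3 : ℝ) - 1 < R3 ∧ R3 < C3))
    (c1 : r0 + R2 ≤ 2 * R1) (c2 : R1 + R3 ≤ 2 * R2) (c3 : R2 + r4 ≤ 2 * R3) :
    3 * (r0 + r4) ≤ 2 * (C1 + C2 + C3) ∧
    ((b1 + b2 + b3 = 3 ∧ r0 + C2 ≤ 2 * C1 ∧ C1 + C3 ≤ 2 * C2 ∧ C2 + r4 ≤ 2 * C3) ∨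
     (b1 + b2 + b3 = 2 ∧ r0 + C2 < 2 * C1 ∧ C1 - 1 + C3 < 2 * C2 ∧ C2 + r4 ≤ 2 * C3 ∧
        r0 + 2 * C3 ≤ 3 * C2) ∨
     (b1 + b2 + b3 = 2 ∧ C2 + r4 < 2 * C3 ∧ C1 - 1 + C3 < 2 * C2 ∧ r0 + C2 ≤ 2 * C1 ∧
        r4 + 2 * C1 ≤ 3 * C2) ∨
     (b1 + b2 + b3 = 2 ∧ C1 + C3 < 2 * C2 ∧ r0 + (C2 - 1) < 2 * C1 ∧ r4 + (C2 - 1) < 2 * C3 ∧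
        2 * r0 + C3 ≤ 3 * C1 ∧ 2 * r4 + C1 ≤ 3 * C3) ∨
     b1 + b2 + b3 ≤ 1) := by
  have e1 : R1 ≤ C1 := by rcases h1 with h | h <;> linarith [h.2]
  have e2 : R2 ≤ C2 := by rcases h2 with h | h <;> linarith [h.2]
  have e3 : R3 ≤ C3 := by rcases h3 with h | h <;> linarith [h.2]
  refine ⟨?_, ?_⟩
  · have : 3 * ((r0 : ℝ) + r4) ≤ 2 * (C1 + C2 + C3) := by linarith
    exact_mod_cast this
  rcases h1 with ⟨rfl, h1⟩ | ⟨rfl, h1, h1'⟩ <;> rcases h2 with ⟨rfl, h2⟩ | ⟨rfl, h2, h2'⟩ <;>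
    rcases h3 with ⟨rfl, h3⟩ | ⟨rfl, h3, h3'⟩
  · left
    subst h1 h2 h3
    exact ⟨rfl, by exact_mod_cast c1, by exact_mod_cast c2, by exact_mod_cast c3⟩
  · right; right; left
    subst h1 h2
    refine ⟨rfl, ?_, ?_, by exact_mod_cast c1, ?_⟩
    · have : (C2 : ℝ) + r4 < 2 * C3 := by linarith
      exact_mod_cast this
    · have : (C1 : ℝ) - 1 + C3 < 2 * C2 := by linarith
      exact_mod_cast this
    · have : (r4 : ℝ) + 2 * C1 ≤ 3 * C2 := by linarith
      exact_mod_cast this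
  · right; right; right; left
    subst h1 h3
    refine ⟨rfl, ?_, ?_, ?_, ?_, ?_⟩
    · have : (C1 : ℝ) + C3 < 2 * C2 := by linarith
      exact_mod_cast this
    · have : (r0 : ℝ) + (C2 - 1) < 2 * C1 := by linarith
      exact_mod_cast this
    · have : (r4 : ℝ) + (C2 - 1) < 2 * C3 := by linarith
      exact_mod_cast this
    · have : 2 * (r0 : ℝ) + C3 ≤ 3 * C1 := by linarith
      exact_mod_cast this
    · have : 2 * (r4 : ℝ) + C1 ≤ 3 * C3 := by linarith
      exact_mod_cast this
  · right; right; right; right; norm_num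
  · right; left
    subst h2 h3
    refine ⟨rfl, ?_, ?_, by exact_mod_cast c3, ?_⟩
    · have : (r0 : ℝ) + C2 < 2 * C1 := by linarith
      exact_mod_cast this
    · have : (C1 : ℝ) - 1 + C3 < 2 * C2 := by linarith
      exact_mod_cast this
    · have : (r0 : ℝ) + 2 * C3 ≤ 3 * C2 := by linarith
      exact_mod_cast this
  · right; right; right; right; norm_num
  · right; right; right; right; norm_num
  · right; right; right; right; norm_num

noncomputable def isI (x : ℝ) : ℤ := if (⌈x⌉ : ℝ) = x then 1 else 0

lemma isI_le (x : ℝ) : isI x ≤ 1 := by unfold isI; split_ifs <;> norm_num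

lemma isI_spec (x : ℝ) : (isI x = 1 ∧ x = ⌈x⌉) ∨
    (isI x = 0 ∧ (⌈x⌉ : ℝ) - 1 < x ∧ x < ⌈x⌉) := by
  unfold isI
  split_ifs with h
  · exact Or.inl ⟨rfl, h.symm⟩
  · refine Or.inr ⟨rfl, ?_, lt_of_le_of_ne (Int.le_ceil x) (Ne.symm h)⟩
    linarith [Int.ceil_lt_add_one x]

lemma full_arith (k : ℤ) (r0 r4 l0 l4 : ℤ) (R1 R2 R3 L1 L2 L3 : ℝ)
    (c1 : r0 + R2 ≤ 2 * R1) (c2 : R1 + R3 ≤ 2 * R2) (c3 : R2 + r4 ≤ 2 * R3)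
    (d1 : l0 + L2 ≤ 2 * L1) (d2 : L1 + L3 ≤ 2 * L2) (d3 : L2 + l4 ≤ 2 * L3)
    (hg : (⌈R1⌉ + ⌈L1⌉ - 1) + (⌈R2⌉ + ⌈L2⌉ - 1) + (⌈R3⌉ + ⌈L3⌉ - 1) = 3 * k + 1) :
    (r0 + l0 + 1) + (r4 + l4 + 1) + (isI R1 + isI R2 + isI R3) + (isI L1 + isI L2 + isI L3)
      ≤ 2 * k + 8 := by
  have A := side_arith r0 r4 _ _ _ _ _ _ R1 R2 R3 (isI_spec _) (isI_spec _) (isI_spec _) c1 c2 c3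
  have B := side_arith l0 l4 _ _ _ _ _ _ L1 L2 L3 (isI_spec _) (isI_spec _) (isI_spec _) d1 d2 d3
  generalize ⌈R1⌉ = C1 at *
  generalize ⌈R2⌉ = C2 at *
  generalize ⌈R3⌉ = C3 at *
  generalize ⌈L1⌉ = F1 at *
  generalize ⌈L2⌉ = F2 at *
  generalize ⌈L3⌉ = F3 at *
  have u1 := isI_le R1
  have u2 := isI_le R2
  have u3 := isI_le R3
  have u4 := isI_le L1
  have u5 := isI_le L2
  have u6 := isI_le L3
  generalize isI R1 + isI R2 + isI R3 = x at *
  generalize isI L1 + isI L2 + isI L3 = y at *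
  clear c1 c2 c3 d1 d2 d3
  obtain ⟨A0, A⟩ := A
  obtain ⟨B0, B⟩ := B
  have hx : x ≤ 3 := by omega
  have hy : y ≤ 3 := by omega
  rcases A with A | A | A | A | A <;> rcases B with B | B | B | B | B
  · obtain ⟨rfl, A1, A2, A3⟩ := A
    obtain ⟨rfl, B1, B2, B3⟩ := B
    obtain ⟨s, hs⟩ : ∃ s, s = r0 + r4 + l0 + l4 := ⟨_, rfl⟩
    obtain ⟨T, hT⟩ : ∃ T, T = C1 + C3 + F1 + F3 := ⟨_, rfl⟩
    obtain ⟨a, ha⟩ : ∃ a, a = C2 + F2 := ⟨_, rfl⟩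
    have t1 : 2 * a + s ≤ 2 * T := by omega
    have t2 : T ≤ 2 * a := by omega
    have t3 : T + a = 3 * k + 4 := by omega
    have t4 : s ≤ 2 * k := by
      clear A1 A2 A3 B1 B2 B3 A0 B0 hg hs hT ha
      omega
    omega
  all_goals omega

lemma row_mem {C : Set (ℝ × ℝ)} (hcv : Convex ℝ C) {l x r y : ℝ} (hl : l ≤ x) (hr : x ≤ r)
    (hlC : ((l, y) : ℝ × ℝ) ∈ C) (hrC : ((r, y) : ℝ × ℝ) ∈ C) : ((x, y) : ℝ × ℝ) ∈ C := by
  rcases eq_or_lt_of_le (hl.trans hr) with h | h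
  · obtain rfl : l = x := by linarith
    exact hlC
  · have h' : 0 < r - l := by linarith
    refine seg_mem hcv hlC hrC ((x - l) / (r - l)) (div_nonneg (by linarith) h'.le) ?_ ?_ ?_
    · rw [div_le_one h']; linarith
    · simp only; field_simp; ring
    · simp only; ring

lemma apex_arith (a m H : ℤ) (hH : 1 ≤ H) (I : Set (ℤ × ℤ))
    (hrows : ∀ p ∈ I, 1 ≤ p.2 ∧ p.2 ≤ 3)
    (hI : ∀ p ∈ I, 0 < (p.1 - m) * H + a * (4 - p.2) ∧
      (p.1 - m) * H + a * (4 - p.2) < H + (4 - p.2)) : I.ncard ≤ 6 := by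
  have key : ∀ x1 y1 x2 y2 x3 y3 : ℤ,
      (y1 + 1 - x1).toNat + ((y2 + 1 - x2).toNat + (y3 + 1 - x3).toNat) ≤ 6 →
      (∀ p ∈ I, (p.2 = 1 → x1 ≤ p.1 ∧ p.1 ≤ y1) ∧ (p.2 = 2 → x2 ≤ p.1 ∧ p.1 ≤ y2) ∧
        (p.2 = 3 → x3 ≤ p.1 ∧ p.1 ≤ y3)) → I.ncard ≤ 6 := by
    intro x1 y1 x2 y2 x3 y3 hc h
    have hsub : I ⊆ ((rowF x1 y1 1 ∪ (rowF x2 y2 2 ∪ rowF x3 y3 3) : Finset (ℤ × ℤ)) :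
        Set (ℤ × ℤ)) := by
      intro p hp
      have := h p hp
      have := hrows p hp
      simp only [Finset.mem_coe, Finset.mem_union, mem_rowF]
      omega
    have h1 := ncard_le_ncard hsub (Finset.finite_toSet _)
    rw [ncard_coe_finset] at h1
    have h2 := Finset.card_union_le (rowF x1 y1 1) (rowF x2 y2 2 ∪ rowF x3 y3 3)
    have h3 := Finset.card_union_le (rowF x2 y2 2) (rowF x3 y3 3)
    simp only [card_rowF] at h2 h3
    omega
  rcases eq_or_lt_of_le hH with h | h
  · subst h
    refine key (m - 3 * a + 1) (m - 3 * a + 3) (m - 2 * a + 1) (m - 2 * a + 2) (m - a + 1)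
      (m - a + 1) (by omega) ?_
    rintro ⟨x, y⟩ hp
    have h1 := hI _ hp
    simp only at h1 ⊢
    refine ⟨?_, ?_, ?_⟩ <;> rintro rfl <;> omega
  · have gen : ∀ x u : ℤ, 1 ≤ u → u ≤ 3 → 0 < (x - m) * H + a * u →
        (x - m) * H + a * u < H + u → m + (-(a * u)) / H + 1 ≤ x ∧ x ≤ m + (-(a * u)) / H + 2 := by
      intro x u hu1 hu3 h1 h2
      rcases eq_or_lt_of_le (show 2 ≤ H by omega) with h' | h'
      · subst h'
        generalize a * u = v at *
        obtain rfl | rfl | rfl : u = 1 ∨ u = 2 ∨ u = 3 := by omega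
        all_goals omega
      · have e1 : H * ((-(a * u)) / H) ≤ -(a * u) := Int.mul_ediv_self_le (by omega)
        have e2 : -(a * u) < H * ((-(a * u)) / H) + H :=
          Int.lt_mul_ediv_self_add (by omega)
        generalize (-(a * u)) / H = q at *
        generalize a * u = v at *
        constructor
        · by_contra! hc
          nlinarith
        · by_contra! hc
          nlinarith
    refine key (m + (-(a * 3)) / H + 1) (m + (-(a * 3)) / H + 2) (m + (-(a * 2)) / H + 1)
      (m + (-(a * 2)) / H + 2) (m + (-(a * 1)) / H + 1) (m + (-(a * 1)) / H + 2) (by omega) ?_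
    rintro ⟨x, y⟩ hp
    have h1 := hI _ hp
    simp only at h1 ⊢
    refine ⟨?_, ?_, ?_⟩ <;> rintro rfl
    · exact gen x 3 (by norm_num) (by norm_num) h1.1 h1.2
    · exact gen x 2 (by norm_num) (by norm_num) h1.1 h1.2
    · exact gen x 1 (by norm_num) (by norm_num) h1.1 h1.2

lemma apex {Q : Set (ℝ × ℝ)} (hQ : Convex ℝ Q)
    (hrows : ∀ p ∈ interiorLatticePoints Q, 1 ≤ p.2 ∧ p.2 ≤ 3) (hg : 7 ≤ polygonGenus Q)
    (w : ℤ × ℤ) (hw : latticeEmbed w ∈ Q) : w.2 ≤ 4 := by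
  by_contra! h
  set H : ℝ := (w.2 : ℝ) - 4 with hH
  have hHpos : 1 ≤ H := by
    have : (5 : ℝ) ≤ w.2 := by exact_mod_cast (show (5 : ℤ) ≤ w.2 by omega)
    rw [hH]; linarith
  have hT : ∀ p ∈ interiorLatticePoints Q,
      (((p.1 : ℝ) * H + w.1 * (4 - p.2)) / (H + (4 - p.2)), (4 : ℝ)) ∈ interior Q := by
    intro p hp
    have h3 : (p.2 : ℝ) ≤ 3 := by exact_mod_cast (hrows p hp).2
    have hd : 0 < H + (4 - (p.2 : ℝ)) := by linarith
    have hp' : latticeEmbed p ∈ interior Q := hp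
    refine int_seg hQ hp' hw ((4 - p.2) / (H + (4 - p.2))) (div_nonneg (by linarith) hd.le) ?_ ?_ ?_
    · rw [div_lt_one hd]; linarith
    · simp only [latticeEmbed]; field_simp; ring
    · simp only [latticeEmbed]; field_simp; rw [hH]; ring
  obtain ⟨p0, hp0⟩ : (interiorLatticePoints Q).Nonempty := by
    apply nonempty_of_ncard_ne_zero
    unfold polygonGenus at hg
    omega
  have h0 := hT p0 hp0
  set t0 := ((p0.1 : ℝ) * H + w.1 * (4 - p0.2)) / (H + (4 - p0.2))
  set m : ℤ := ⌊t0⌋ with hm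
  have hm1 : (m : ℝ) ≤ t0 := Int.floor_le t0
  have hm2 : t0 < m + 1 := Int.lt_floor_add_one t0
  clear_value t0 m
  have hno : ∀ z : ℤ, ((z : ℝ), (4 : ℝ)) ∉ interior Q := by
    intro z hz
    have := hrows (z, 4) (by simpa [interiorLatticePoints, latticeEmbed] using hz)
    omega
  have hband : ∀ t : ℝ, (t, (4 : ℝ)) ∈ interior Q → m < t ∧ t < m + 1 := by
    intro t ht
    constructor
    · by_contra! hc
      exact hno m (row_mem hQ.interior hc hm1 ht h0)
    · by_contra! hc
      refine hno (m + 1) (row_mem hQ.interior ?_ ?_ h0 ht) <;> push_cast <;> linarith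
  have := apex_arith (w.1 - m) m (w.2 - 4) (by omega) (interiorLatticePoints Q) hrows ?_
  · unfold polygonGenus at hg
    omega
  · intro p hp
    have h3 : (p.2 : ℝ) ≤ 3 := by exact_mod_cast (hrows p hp).2
    have hd : 0 < H + (4 - (p.2 : ℝ)) := by linarith
    obtain ⟨e1, e2⟩ := hband _ (hT p hp)
    rw [lt_div_iff₀ hd] at e1
    rw [div_lt_iff₀ hd] at e2
    rw [hH] at e1 e2
    have e1' : m * ((w.2 - 4) + (4 - p.2)) < p.1 * (w.2 - 4) + w.1 * (4 - p.2) := by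
      exact_mod_cast e1
    have e2' : p.1 * (w.2 - 4) + w.1 * (4 - p.2) < (m + 1) * ((w.2 - 4) + (4 - p.2)) := by
      exact_mod_cast e2
    constructor
    · linear_combination e1'
    · linear_combination e2'

noncomputable def bdF (x : ℝ) (y : ℤ) : Finset (ℤ × ℤ) :=
  open Classical in if (⌈x⌉ : ℝ) = x then {(⌈x⌉, y)} else ∅

lemma card_bdF (x : ℝ) (y : ℤ) : ((bdF x y).card : ℤ) = isI x := by
  unfold bdF isI
  split_ifs <;> simp

lemma mem_bdF (z y : ℤ) : (z, y) ∈ bdF (z : ℝ) y := by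
  unfold bdF
  simp

lemma isI_neg (x : ℝ) : isI (-x) = isI x := by
  have : ∀ x : ℝ, (⌈x⌉ : ℝ) = x ↔ ∃ z : ℤ, (z : ℝ) = x := by
    intro x
    constructor
    · intro h; exact ⟨_, h⟩
    · rintro ⟨z, rfl⟩; simp
  have h : (∃ z : ℤ, (z : ℝ) = -x) ↔ ∃ z : ℤ, (z : ℝ) = x := by
    constructor
    · rintro ⟨z, h⟩; exact ⟨-z, by push_cast; linarith⟩
    · rintro ⟨z, h⟩; exact ⟨-z, by push_cast; linarith⟩
  have key : ((⌈-x⌉ : ℝ) = -x) ↔ (⌈x⌉ : ℝ) = x := by rw [this, this, h]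
  unfold isI
  by_cases hx : (⌈x⌉ : ℝ) = x
  · rw [if_pos hx, if_pos (key.2 hx)]
  · rw [if_neg hx, if_neg (fun h' => hx (key.1 h'))]

set_option maxHeartbeats 1000000 in
lemma strip_main {Q : Set (ℝ × ℝ)} (hQ : IsLatticePolygon Q) (k : ℕ) (hk : 2 ≤ k)
    (hrows : ∀ p ∈ interiorLatticePoints Q, 1 ≤ p.2 ∧ p.2 ≤ 3)
    (hr1 : ∃ p ∈ interiorLatticePoints Q, p.2 = 1)
    (hr3 : ∃ p ∈ interiorLatticePoints Q, p.2 = 3)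
    (hg : polygonGenus Q = 3 * k + 1) : boundaryLatticeCount Q ≤ 2 * k + 8 := by
  obtain ⟨S, hS, hQS⟩ := id hQ
  have hcv : Convex ℝ Q := by rw [hQS]; exact convex_convexHull _ _
  have hcomp : IsCompact Q := by
    rw [hQS]; exact Set.Finite.isCompact_convexHull ℝ ((Finset.finite_toSet S).image _)
  have hmem : ∀ w ∈ S, latticeEmbed w ∈ Q := by
    intro w hw; rw [hQS]; exact subset_convexHull _ _ ⟨w, hw, rfl⟩
  have hup : ∀ w ∈ S, w.2 ≤ 4 := fun w hw => apex hcv hrows (by omega) w (hmem w hw)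
  have hlow : ∀ w ∈ S, 0 ≤ w.2 := by
    intro w hw
    have hz : IsZAffine (fun p : ℝ × ℝ => ((p.1, 4 - p.2) : ℝ × ℝ)) := by
      refine ⟨1, 0, 0, -1, 0, 4, by norm_num, fun p => ?_⟩
      ext
      · simp
      · simp; ring
    obtain ⟨S', -, hS'⟩ := polygon_image hz hQ
    have hcv' : Convex ℝ ((fun p : ℝ × ℝ => ((p.1, 4 - p.2) : ℝ × ℝ)) '' Q) := by
      rw [hS']; exact convex_convexHull _ _
    have := apex hcv' ?_ ?_ (w.1, 4 - w.2) ⟨_, hmem w hw, by simp [latticeEmbed]⟩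
    · simp only at this; omega
    · intro p hp
      obtain ⟨q, hq, hpq⟩ := (interior_image hz Q p).1 hp
      have h2 := hrows q hq
      have : (p.2 : ℝ) = 4 - q.2 := congrArg Prod.snd hpq
      have : p.2 = 4 - q.2 := by exact_mod_cast this
      omega
    · rw [genus_image hz, hg]; omega
  have hhalf : ∀ (α β : ℝ), (∀ w ∈ S, α * w.2 ≤ β) → ∀ q ∈ Q, α * q.2 ≤ β := by
    intro α β h
    have : Q ⊆ {q : ℝ × ℝ | α * q.2 ≤ β} := by
      rw [hQS]
      apply convexHull_min
      · rintro _ ⟨w, hw, rfl⟩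
        exact h w hw
      · rintro ⟨x1, x2⟩ hx ⟨y1, y2⟩ hy a b ha hb hab
        obtain rfl : b = 1 - a := by linarith
        simp only [mem_ofPred_eq, Prod.smul_mk, smul_eq_mul, Prod.mk_add_mk] at *
        nlinarith
    exact this
  have hQup : ∀ q ∈ Q, q.2 ≤ 4 := by
    intro q hq
    have := hhalf 1 4 (fun w hw => by rw [one_mul]; exact_mod_cast hup w hw) q hq
    linarith
  have hQlow : ∀ q ∈ Q, 0 ≤ q.2 := by
    intro q hq
    have := hhalf (-1) 0 (fun w hw => by
      have : (0 : ℝ) ≤ w.2 := by exact_mod_cast hlow w hw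
      linarith) q hq
    linarith
  obtain ⟨w0, hw0, hw0'⟩ : ∃ w ∈ S, w.2 = 0 := by
    by_contra! hc
    obtain ⟨p, hp, hp1⟩ := hr1
    obtain ⟨t, ht, h⟩ := interior_move hp 0 (-1)
    have := hhalf (-1) (-1) (fun w hw => by
      have h1 := hc w hw
      have h2 := hlow w hw
      have : (1 : ℝ) ≤ w.2 := by exact_mod_cast (show (1 : ℤ) ≤ w.2 by omega)
      linarith) _ h
    simp only [latticeEmbed, hp1] at this
    push_cast at this
    linarith
  obtain ⟨w4, hw4, hw4'⟩ : ∃ w ∈ S, w.2 = 4 := by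
    by_contra! hc
    obtain ⟨p, hp, hp1⟩ := hr3
    obtain ⟨t, ht, h⟩ := interior_move hp 0 1
    have := hhalf 1 3 (fun w hw => by
      have h1 := hc w hw
      have h2 := hup w hw
      have : (w.2 : ℝ) ≤ 3 := by exact_mod_cast (show w.2 ≤ (3 : ℤ) by omega)
      linarith) _ h
    simp only [latticeEmbed, hp1] at this
    push_cast at this
    linarith
  have m0 : ((w0.1 : ℝ), (0 : ℝ)) ∈ Q := by
    have := hmem _ hw0
    simpa [latticeEmbed, hw0'] using this
  have m4 : ((w4.1 : ℝ), (4 : ℝ)) ∈ Q := by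
    have := hmem _ hw4
    simpa [latticeEmbed, hw4'] using this
  have hLR : ∀ y : ℝ, ∃ L R : ℝ, 0 ≤ y → y ≤ 4 → ((L, y) : ℝ × ℝ) ∈ Q ∧ ((R, y) : ℝ × ℝ) ∈ Q ∧
      ∀ x : ℝ, ((x, y) : ℝ × ℝ) ∈ Q → L ≤ x ∧ x ≤ R := by
    intro y
    by_cases hy : 0 ≤ y ∧ y ≤ 4
    · have hK : IsCompact (Q ∩ {q : ℝ × ℝ | q.2 = y}) :=
        hcomp.inter_right (isClosed_eq continuous_snd continuous_const)
      have hne : (Q ∩ {q : ℝ × ℝ | q.2 = y}).Nonempty := by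
        refine ⟨((1 - y / 4) * w0.1 + y / 4 * w4.1, y), ?_, rfl⟩
        exact seg_mem hcv m0 m4 (y / 4) (by linarith) (by linarith) rfl (by simp)
      obtain ⟨a, ha, hamin⟩ := hK.exists_isMinOn hne continuous_fst.continuousOn
      obtain ⟨b, hb, hbmax⟩ := hK.exists_isMaxOn hne continuous_fst.continuousOn
      refine ⟨a.1, b.1, fun _ _ => ⟨?_, ?_, ?_⟩⟩
      · have h2 : a.2 = y := ha.2
        rw [← h2]; exact ha.1
      · have h2 : b.2 = y := hb.2
        rw [← h2]; exact hb.1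
      · intro x hx
        exact ⟨hamin (show ((x, y) : ℝ × ℝ) ∈ _ from ⟨hx, rfl⟩),
          hbmax (show ((x, y) : ℝ × ℝ) ∈ _ from ⟨hx, rfl⟩)⟩
    · exact ⟨0, 0, fun h1 h2 => absurd ⟨h1, h2⟩ hy⟩
  choose L R hLR using hLR
  have conc : ∀ y : ℝ, 1 ≤ y → y ≤ 3 → 2 * L y ≤ L (y - 1) + L (y + 1) ∧
      R (y - 1) + R (y + 1) ≤ 2 * R y := by
    intro y h1 h3
    obtain ⟨-, -, e⟩ := hLR y (by linarith) (by linarith)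
    obtain ⟨a1, a2, -⟩ := hLR (y - 1) (by linarith) (by linarith)
    obtain ⟨b1, b2, -⟩ := hLR (y + 1) (by linarith) (by linarith)
    have c1 := e ((L (y - 1) + L (y + 1)) / 2)
      (seg_mem hcv a1 b1 (1 / 2) (by norm_num) (by norm_num) (by simp only; ring)
        (by simp only; ring))
    have c2 := e ((R (y - 1) + R (y + 1)) / 2)
      (seg_mem hcv a2 b2 (1 / 2) (by norm_num) (by norm_num) (by simp only; ring)
        (by simp only; ring))
    constructor <;> linarith [c1.1, c2.2]
  have hintrow : ∀ y : ℝ, 0 < y → y < 4 → ∃ x : ℝ, ((x, y) : ℝ × ℝ) ∈ interior Q := by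
    intro y hy0 hy4
    obtain ⟨p, hp, hp1⟩ := hr1
    have hp' : latticeEmbed p ∈ interior Q := hp
    have h1 : latticeEmbed p = ((p.1 : ℝ), (1 : ℝ)) := by simp [latticeEmbed, hp1]
    rw [h1] at hp'
    rcases le_total y 1 with h | h
    · exact ⟨(1 - (1 - y)) * p.1 + (1 - y) * w0.1,
        int_seg hcv hp' m0 (1 - y) (by linarith) (by linarith) rfl (by simp only; ring)⟩
    · exact ⟨(1 - (y - 1) / 3) * p.1 + ((y - 1) / 3) * w4.1,
        int_seg hcv hp' m4 ((y - 1) / 3) (by linarith) (by linarith) rfl (by simp only; ring)⟩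
  have hintiff : ∀ x y : ℝ, 0 < y → y < 4 → (((x, y) : ℝ × ℝ) ∈ interior Q ↔ L y < x ∧ x < R y) := by
    intro x y h0 h4
    obtain ⟨a, b, e⟩ := hLR y h0.le h4.le
    constructor
    · intro h
      obtain ⟨t1, ht1, h1⟩ := interior_move h 1 0
      obtain ⟨t2, ht2, h2⟩ := interior_move h (-1) 0
      simp only [mul_zero, add_zero] at h1 h2
      have := (e _ h1).2
      have := (e _ h2).1
      constructor <;> linarith
    · rintro ⟨h1, h2⟩
      obtain ⟨z, hz⟩ := hintrow y h0 h4
      refine line_int hcv 1 0 (x - L y) (R y - x) (by linarith) (by linarith) (by norm_num) ?_ ?_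
        hz m4 ?_ ?_
      · convert a using 2 <;> ring
      · convert b using 2 <;> ring
      · simp
      · simp only; linarith
  have hlt : ∀ y : ℝ, 0 < y → y < 4 → L y < R y := by
    intro y h0 h4
    obtain ⟨z, hz⟩ := hintrow y h0 h4
    have := (hintiff z y h0 h4).1 hz
    linarith
  have hle0 : ⌈L 0⌉ ≤ ⌊R 0⌋ := by
    have := (hLR 0 (by norm_num) (by norm_num)).2.2 _ m0
    exact (Int.ceil_le.2 this.1).trans (Int.le_floor.2 this.2)
  have hle4 : ⌈L 4⌉ ≤ ⌊R 4⌋ := by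
    have := (hLR 4 (by norm_num) (by norm_num)).2.2 _ m4
    exact (Int.ceil_le.2 this.1).trans (Int.le_floor.2 this.2)
  -- genus
  have hI : interiorLatticePoints Q = ((rowF (⌊L 1⌋ + 1) (⌈R 1⌉ - 1) 1 ∪
      (rowF (⌊L 2⌋ + 1) (⌈R 2⌉ - 1) 2 ∪ rowF (⌊L 3⌋ + 1) (⌈R 3⌉ - 1) 3) : Finset (ℤ × ℤ)) :
      Set (ℤ × ℤ)) := by
    have aux : ∀ x j : ℤ, 0 < j → j < 4 → ((x, j) ∈ interiorLatticePoints Q ↔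
        ⌊L j⌋ + 1 ≤ x ∧ x ≤ ⌈R j⌉ - 1) := by
      intro x j h0 h4
      show ((x : ℝ), (j : ℝ)) ∈ interior Q ↔ _
      rw [hintiff _ _ (by exact_mod_cast h0) (by exact_mod_cast h4), ← Int.floor_lt, ← Int.lt_ceil]
      omega
    have a1 := fun x => aux x 1 (by norm_num) (by norm_num)
    have a2 := fun x => aux x 2 (by norm_num) (by norm_num)
    have a3 := fun x => aux x 3 (by norm_num) (by norm_num)
    push_cast at a1 a2 a3
    ext ⟨x, y⟩
    simp only [Finset.mem_coe, Finset.mem_union, mem_rowF, ← a1, ← a2, ← a3]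
    constructor
    · intro h
      have := hrows _ h
      simp only at this
      obtain rfl | rfl | rfl : y = 1 ∨ y = 2 ∨ y = 3 := by omega
      all_goals simp [h]
    · rintro (⟨h, rfl⟩ | ⟨h, rfl⟩ | ⟨h, rfl⟩) <;> exact h
  have hcard : ∀ y : ℝ, 0 < y → y < 4 → 0 ≤ ⌈R y⌉ - 1 + 1 - (⌊L y⌋ + 1) := by
    intro y h0 h4
    have h1 := hlt y h0 h4
    have : ⌊L y⌋ < ⌈R y⌉ := by
      rw [Int.lt_ceil]
      exact lt_of_le_of_lt (Int.floor_le _) h1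
    omega
  have hgen : (⌈R 1⌉ + ⌈-L 1⌉ - 1) + (⌈R 2⌉ + ⌈-L 2⌉ - 1) + (⌈R 3⌉ + ⌈-L 3⌉ - 1)
      = 3 * (k : ℤ) + 1 := by
    unfold polygonGenus at hg
    rw [hI, ncard_coe_finset, Finset.card_union_of_disjoint, Finset.card_union_of_disjoint] at hg
    · simp only [card_rowF] at hg
      have := hcard 1 (by norm_num) (by norm_num)
      have := hcard 2 (by norm_num) (by norm_num)
      have := hcard 3 (by norm_num) (by norm_num)
      simp only [Int.ceil_neg]
      omega
    · exact disj_rowF (by norm_num)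
    · rw [Finset.disjoint_union_right]
      exact ⟨disj_rowF (by norm_num), disj_rowF (by norm_num)⟩
  -- boundary
  have hB : {p : ℤ × ℤ | latticeEmbed p ∈ frontier Q} ⊆
      ((rowF ⌈L 0⌉ ⌊R 0⌋ 0 ∪ (rowF ⌈L 4⌉ ⌊R 4⌋ 4 ∪ ((bdF (R 1) 1 ∪ (bdF (R 2) 2 ∪ bdF (R 3) 3)) ∪
        (bdF (L 1) 1 ∪ (bdF (L 2) 2 ∪ bdF (L 3) 3)))) : Finset (ℤ × ℤ)) : Set (ℤ × ℤ)) := by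
    rintro ⟨x, y⟩ hp
    rw [mem_ofPred_eq, hcomp.isClosed.frontier_eq] at hp
    obtain ⟨hp1, hp2⟩ := hp
    simp only [latticeEmbed] at hp1 hp2
    have h0 : 0 ≤ y := by
      have : (0 : ℝ) ≤ (y : ℝ) := hQlow _ hp1
      exact_mod_cast this
    have h4 : y ≤ 4 := by
      have : (y : ℝ) ≤ (4 : ℝ) := hQup _ hp1
      exact_mod_cast this
    have e := (hLR y (by exact_mod_cast h0) (by exact_mod_cast h4)).2.2 _ hp1
    have hend : 0 < y → y < 4 → (x, y) ∈ bdF (R y) y ∨ (x, y) ∈ bdF (L y) y := by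
      intro h0 h4
      rw [hintiff _ _ (by exact_mod_cast h0) (by exact_mod_cast h4)] at hp2
      rcases eq_or_lt_of_le e.1 with h | h
      · right; rw [h]; exact mem_bdF x y
      · left
        have : R y = x := le_antisymm (not_lt.1 (fun h' => hp2 ⟨h, h'⟩)) e.2
        rw [this]; exact mem_bdF x y
    simp only [Finset.mem_coe, Finset.mem_union, mem_rowF]
    obtain rfl | rfl | rfl | rfl | rfl : y = 0 ∨ y = 1 ∨ y = 2 ∨ y = 3 ∨ y = 4 := by omega
    · push_cast at e
      exact Or.inl ⟨⟨Int.ceil_le.2 e.1, Int.le_floor.2 e.2⟩, rfl⟩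
    · have := hend (by norm_num) (by norm_num)
      push_cast at this
      rcases this with h | h <;> simp only [h, true_or, or_true]
    · have := hend (by norm_num) (by norm_num)
      push_cast at this
      rcases this with h | h <;> simp only [h, true_or, or_true]
    · have := hend (by norm_num) (by norm_num)
      push_cast at this
      rcases this with h | h <;> simp only [h, true_or, or_true]
    · push_cast at e
      exact Or.inr (Or.inl ⟨⟨Int.ceil_le.2 e.1, Int.le_floor.2 e.2⟩, rfl⟩)
  have hBc := ncard_le_ncard hB (Finset.finite_toSet _)
  rw [ncard_coe_finset] at hBc
  have u1 := Finset.card_union_le (rowF ⌈L 0⌉ ⌊R 0⌋ 0) (rowF ⌈L 4⌉ ⌊R 4⌋ 4 ∪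
    ((bdF (R 1) 1 ∪ (bdF (R 2) 2 ∪ bdF (R 3) 3)) ∪ (bdF (L 1) 1 ∪ (bdF (L 2) 2 ∪ bdF (L 3) 3))))
  have u2 := Finset.card_union_le (rowF ⌈L 4⌉ ⌊R 4⌋ 4)
    ((bdF (R 1) 1 ∪ (bdF (R 2) 2 ∪ bdF (R 3) 3)) ∪ (bdF (L 1) 1 ∪ (bdF (L 2) 2 ∪ bdF (L 3) 3)))
  have u3 := Finset.card_union_le (bdF (R 1) 1 ∪ (bdF (R 2) 2 ∪ bdF (R 3) 3))
    (bdF (L 1) 1 ∪ (bdF (L 2) 2 ∪ bdF (L 3) 3))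
  have u4 := Finset.card_union_le (bdF (R 1) 1) (bdF (R 2) 2 ∪ bdF (R 3) 3)
  have u5 := Finset.card_union_le (bdF (R 2) 2) (bdF (R 3) 3)
  have u6 := Finset.card_union_le (bdF (L 1) 1) (bdF (L 2) 2 ∪ bdF (L 3) 3)
  have u7 := Finset.card_union_le (bdF (L 2) 2) (bdF (L 3) 3)
  have f1 := card_bdF (R 1) 1
  have f2 := card_bdF (R 2) 2
  have f3 := card_bdF (R 3) 3
  have f4 := card_bdF (L 1) 1
  have f5 := card_bdF (L 2) 2
  have f6 := card_bdF (L 3) 3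
  have q1 := conc 1 (by norm_num) (by norm_num)
  have q2 := conc 2 (by norm_num) (by norm_num)
  have q3 := conc 3 (by norm_num) (by norm_num)
  norm_num at q1 q2 q3
  have z1 := Int.floor_le (R 0)
  have z2 := Int.floor_le (R 4)
  have z3 := Int.le_ceil (L 0)
  have z4 := Int.le_ceil (L 4)
  have fin := full_arith k ⌊R 0⌋ ⌊R 4⌋ (-⌈L 0⌉) (-⌈L 4⌉) (R 1) (R 2) (R 3) (-L 1) (-L 2) (-L 3)
    (by linarith [q1.2]) (by linarith [q2.2]) (by linarith [q3.2])
    (by push_cast; linarith [q1.1]) (by linarith [q2.1]) (by push_cast; linarith [q3.1]) hgen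
  simp only [isI_neg] at fin
  have g0 := card_rowF ⌈L 0⌉ ⌊R 0⌋ 0
  have g4 := card_rowF ⌈L 4⌉ ⌊R 4⌋ 4
  unfold boundaryLatticeCount
  omega

lemma upper (k : ℕ) (hk : 2 ≤ k) (P : Set (ℝ × ℝ)) (hP : IsLatticePolygon P)
    (hg : polygonGenus P = 3 * k + 1) (hw : LatticeWidthIs (interiorPolygon P) 2) :
    boundaryLatticeCount P ≤ 2 * k + 8 := by
  obtain ⟨⟨-, φ, hφ, hsub⟩, hmin⟩ := hw
  obtain ⟨a, b, c, d, e, f, hdet, h⟩ := id hφ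
  have hin : ∀ p ∈ interiorLatticePoints P,
      0 ≤ c * p.1 + d * p.2 + f ∧ c * p.1 + d * p.2 + f ≤ 2 := by
    intro p hp
    have := hsub ⟨_, subset_convexHull _ _ ⟨p, hp, rfl⟩, rfl⟩
    rw [h] at this
    simp only [strip, latticeEmbed, mem_ofPred_eq] at this
    exact_mod_cast this
  have hshift : ∀ n : ℤ, IsZAffine (fun p : ℝ × ℝ => (((a : ℝ) * p.1 + (b : ℝ) * p.2 + (e : ℝ),
             (c : ℝ) * p.1 + (d : ℝ) * p.2 + ((f + n : ℤ) : ℝ)) : ℝ × ℝ)) := fun n =>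
    ⟨a, b, c, d, e, f + n, hdet, fun p => rfl⟩
  have hno : ∀ n : ℤ, ¬ ∀ p ∈ interiorLatticePoints P,
      0 ≤ c * p.1 + d * p.2 + (f + n) ∧ c * p.1 + d * p.2 + (f + n) ≤ 1 := by
    intro n hn
    have := hmin (show (1 : ℕ) ∈ _ from ⟨one_pos, _, hshift n, strip_of (hshift n) P _ ?_⟩)
    · omega
    · intro p hp
      have := hn p hp
      simp only [strip, latticeEmbed, mem_ofPred_eq]
      exact_mod_cast this
  rw [← boundary_image (hshift 1) P]
  have himg : ∀ p q : ℤ × ℤ, latticeEmbed p = (((a : ℝ) * (latticeEmbed q).1 +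
      (b : ℝ) * (latticeEmbed q).2 + (e : ℝ), (c : ℝ) * (latticeEmbed q).1 +
      (d : ℝ) * (latticeEmbed q).2 + ((f + 1 : ℤ) : ℝ)) : ℝ × ℝ) →
      p.2 = c * q.1 + d * q.2 + (f + 1) := by
    intro p q hpq
    have := congrArg Prod.snd hpq
    simp only [latticeEmbed] at this
    exact_mod_cast this
  have hex : ∀ q ∈ interiorLatticePoints P, ((a * q.1 + b * q.2 + e, c * q.1 + d * q.2 + (f + 1)) :
      ℤ × ℤ) ∈ interiorLatticePoints ((fun p : ℝ × ℝ => (((a : ℝ) * p.1 + (b : ℝ) * p.2 + (e : ℝ),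
             (c : ℝ) * p.1 + (d : ℝ) * p.2 + ((f + 1 : ℤ) : ℝ)) : ℝ × ℝ)) '' P) := by
    intro q hq
    rw [interior_image (hshift 1)]
    exact ⟨q, hq, by simp [latticeEmbed]⟩
  refine strip_main (polygon_image (hshift 1) hP) k hk ?_ ?_ ?_ ?_
  · intro p hp
    obtain ⟨q, hq, hpq⟩ := (interior_image (hshift 1) P p).1 hp
    have := himg p q hpq
    have := hin q hq
    omega
  · have h1 := hno (-1)
    push Not at h1
    obtain ⟨q, hq, hq'⟩ := h1
    refine ⟨_, hex q hq, ?_⟩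
    have := hin q hq
    simp only
    by_contra hc
    have := hq' (by omega)
    omega
  · have h1 := hno 0
    push Not at h1
    obtain ⟨q, hq, hq'⟩ := h1
    refine ⟨_, hex q hq, ?_⟩
    have := hin q hq
    have := hq' (by omega)
    simp only
    omega
  · rw [genus_image (hshift 1), hg]

end Stmt12Aux

/-- For `g ≥ 7` with `g ≡ 1 (mod 3)`, the maximum of `g + r(P) − 3 − c(P)` over
maximal lattice polygons `P` of genus `g` and expected gonality `4` equals
`(5g + 13)/3 = ⌊U(g, 4)⌋`. -/
theorem stmt12 (g : ℕ) (hg : 7 ≤ g) (hmod : g % 3 = 1) :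
    (∃ P : Set (ℝ × ℝ), IsMaximalPolygon P ∧ polygonGenus P = g ∧
      ExpectedGonalityIs P 4 ∧
      (g : ℚ) + (boundaryLatticeCount P : ℚ) - 3 - (columnVectorCount P : ℚ) =
        (5 * (g : ℚ) + 13) / 3) ∧
    ∀ P : Set (ℝ × ℝ), IsMaximalPolygon P → polygonGenus P = g →
      ExpectedGonalityIs P 4 →
      (g : ℚ) + (boundaryLatticeCount P : ℚ) - 3 - (columnVectorCount P : ℚ) ≤
        (5 * (g : ℚ) + 13) / 3 := by
  obtain ⟨k, rfl⟩ : ∃ k, g = 3 * k + 1 := ⟨g / 3, by omega⟩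
  have hk : 2 ≤ k := by omega
  refine ⟨⟨Stmt12Aux.hexSet k, Stmt12Aux.hex_maximal k hk, Stmt12Aux.hex_genus k,
    Stmt12Aux.hex_gonality k hk, ?_⟩, ?_⟩
  · rw [Stmt12Aux.hex_boundary, Stmt12Aux.hex_column k hk]
    push_cast
    ring
  · intro P hP hgP hgon
    rcases hgon with ⟨-, h⟩ | ⟨-, w, hw, h⟩
    · omega
    · obtain rfl : w = 2 := by omega
      have h1 : (boundaryLatticeCount P : ℚ) ≤ 2 * k + 8 := by
        exact_mod_cast Stmt12Aux.upper k hk P hP.1 hgP hw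
      have h2 : (0 : ℚ) ≤ columnVectorCount P := Nat.cast_nonneg _
      push_cast
      linarith
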